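/- Let 0 < α_i < 1 for i = 1,…,d, E = diag(1/α_1,…,1/α_d), and let I_<, I_=, I_> be a partition of {1,…,d} with Σ_{k∈I_=∪I_>} 1/α_k > 2 and Σ_{k∈I_>} 1/α_k < 2; write I_≤ = I_< ∪ I_=, let H_< be the coordinate subspace of ℝ^d of coordinates in I_<, and let π_≥ be the orthogonal projection onto the coordinate subspace of coordinates in I_= ∪ I_>. Let Λ : ℝ^d → ℂ be continuous, E-homogeneous (Λ(t^E x) = tΛ(x) for t > 0) and with Λ(x) ≠ 0 for x ≠ 0. Then the function h(y) = (sup_{x∈H_<} |Λ(x + π_≥ y)|^{-2}) · Π_{k∈I_≤} min{1, 1/y_k²} is integrable on ℝ^d. -/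

import Mathlib

open MeasureTheory Finset
open scoped ENNReal

/-- The Lebesgue integral of a product of functions of separate coordinates. -/
theorem lintegral_fin_prod_eq_prod {n : ℕ} (f : Fin n → ℝ → ℝ≥0∞) (hf : ∀ i, Measurable (f i)) :
    ∫⁻ x : Fin n → ℝ, ∏ i, f i (x i) = ∏ i, ∫⁻ u, f i u := by
  induction n with
  | zero => simp [volume_pi]
  | succ n ih =>
    have hmp := (volume_preserving_piFinSuccAbove (fun _ : Fin (n + 1) => ℝ) 0).symm
    rw [← hmp.lintegral_comp_emb (MeasurableEquiv.measurableEmbedding _)]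
    have hprod : ∀ z : ℝ × (Fin n → ℝ),
        ∏ i, f i ((MeasurableEquiv.piFinSuccAbove (fun _ : Fin (n + 1) => ℝ) 0).symm z i)
          = f 0 z.1 * ∏ i : Fin n, f i.succ (z.2 i) := by
      intro z
      simp [Fin.prod_univ_succ, MeasurableEquiv.piFinSuccAbove_symm_apply, Fin.insertNthEquiv]
    simp_rw [hprod]
    rw [Measure.volume_eq_prod, lintegral_prod_mul (g := fun x : Fin n → ℝ => ∏ i : Fin n, f i.succ (x i))
      (hf 0).aemeasurable ?_, ih _ fun i => hf i.succ,
      Fin.prod_univ_succ]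
    exact (Finset.measurable_prod _ fun i _ =>
      (hf i.succ).comp (measurable_pi_apply i)).aemeasurable

/-- The power `|u|^{-a}`, cut off to `|u| > 1`. -/
noncomputable def tailPower (a u : ℝ) : ℝ≥0∞ :=
  {u : ℝ | 1 < |u|}.indicator (fun u => (‖u‖ₑ⁻¹) ^ a) u

/-- The power `|u|^{-a}`, damped by the factor `min {1, u⁻²}`. -/
noncomputable def dampedPower (a u : ℝ) : ℝ≥0∞ :=
  (‖u‖ₑ⁻¹) ^ a * min 1 (ENNReal.ofReal (u ^ 2))⁻¹

theorem measurable_tailPower (a : ℝ) : Measurable (tailPower a) := by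
  refine Measurable.indicator (by fun_prop) ?_
  exact measurableSet_lt measurable_const measurable_norm

theorem measurable_dampedPower (a : ℝ) : Measurable (dampedPower a) := by
  unfold dampedPower
  fun_prop

theorem enorm_inv_rpow_eq_ofReal {u : ℝ} (hu : u ≠ 0) (a : ℝ) :
    (‖u‖ₑ⁻¹) ^ a = ENNReal.ofReal (|u| ^ (-a)) := by
  rw [ENNReal.inv_rpow, ← ENNReal.rpow_neg, Real.enorm_eq_ofReal_abs,
    ENNReal.ofReal_rpow_of_pos (abs_pos.2 hu)]

theorem lintegral_tailPower_lt_top {a : ℝ} (ha : 1 < a) : ∫⁻ u, tailPower a u < ⊤ := by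
  have hint : ∫⁻ u : ℝ, ENNReal.ofReal ((1 + ‖u‖) ^ (-a)) < ⊤ :=
    finite_integral_one_add_norm (by simpa using ha)
  have hle : ∀ u, tailPower a u ≤ ENNReal.ofReal (2 ^ a) * ENNReal.ofReal ((1 + ‖u‖) ^ (-a)) := by
    intro u
    refine Set.indicator_apply_le' (fun hu => ?_) fun _ => zero_le
    have hu : 1 < |u| := hu
    have hu0 : u ≠ 0 := by rintro rfl; simp at hu; linarith
    rw [enorm_inv_rpow_eq_ofReal hu0, ← ENNReal.ofReal_mul (by positivity)]
    refine ENNReal.ofReal_le_ofReal ?_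
    rw [Real.norm_eq_abs, Real.rpow_neg (by positivity), Real.rpow_neg (by positivity),
      ← div_eq_mul_inv, inv_eq_one_div, div_le_div_iff₀ (by positivity) (by positivity), one_mul,
      ← Real.mul_rpow (by norm_num) (by positivity)]
    exact Real.rpow_le_rpow (by positivity) (by linarith) (by linarith)
  refine (lintegral_mono hle).trans_lt ?_
  rw [lintegral_const_mul' _ _ ENNReal.ofReal_ne_top]
  exact ENNReal.mul_lt_top ENNReal.ofReal_lt_top hint

theorem lintegral_dampedPower_lt_top {a : ℝ} (ha0 : 0 ≤ a) (ha : a < 1) :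
    ∫⁻ u, dampedPower a u < ⊤ := by
  have hloc : IntegrableOn (fun u : ℝ => |u| ^ (-a)) (Metric.ball 0 2) := by
    refine integrableOn_ball_of_norm_le_rpow (C := 1) (α := a) (by simp) (by simpa using ha)
      (Filter.Eventually.of_forall fun u => ?_)
      (by fun_prop : Measurable fun u : ℝ => |u| ^ (-a)).aestronglyMeasurable
    rw [Real.norm_eq_abs, abs_of_nonneg (by positivity), one_mul, Real.norm_eq_abs]
  have hint : ∫⁻ u in Metric.ball (0 : ℝ) 2, ENNReal.ofReal (|u| ^ (-a)) < ⊤ :=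
    hloc.lintegral_lt_top
  rw [← lintegral_indicator Metric.isOpen_ball.measurableSet] at hint
  have hle : ∀ᵐ u : ℝ, dampedPower a u ≤
      (Metric.ball (0 : ℝ) 2).indicator (fun u => ENNReal.ofReal (|u| ^ (-a))) u
        + tailPower 2 u := by
    have hne : ∀ᵐ u : ℝ, u ≠ 0 := by simp [ae_iff]
    filter_upwards [hne] with u hu
    unfold dampedPower
    by_cases h1 : |u| ≤ 1
    · refine le_add_right ?_
      rw [Set.indicator_of_mem (by simp; linarith), ← enorm_inv_rpow_eq_ofReal hu]
      exact mul_le_of_le_one_right' (min_le_left _ _)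
    · refine le_add_left ?_
      have h1 : 1 < |u| := not_le.1 h1
      rw [tailPower, Set.indicator_of_mem (by exact h1)]
      have hx : ‖u‖ₑ⁻¹ ≤ 1 := by
        rw [ENNReal.inv_le_one, Real.enorm_eq_ofReal_abs]
        simpa using h1.le
      have hsq : (ENNReal.ofReal (u ^ 2))⁻¹ = (‖u‖ₑ⁻¹) ^ (2 : ℝ) := by
        rw [Real.enorm_eq_ofReal_abs, ← sq_abs, ENNReal.ofReal_pow (abs_nonneg u),
          ENNReal.inv_rpow]
        norm_num
      rw [← hsq]
      exact (mul_le_of_le_one_left' (ENNReal.rpow_le_one hx ha0)).trans (min_le_right _ _)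
  refine (lintegral_mono_ae hle).trans_lt ?_
  rw [lintegral_add_right _ (measurable_tailPower 2)]
  exact ENNReal.add_lt_top.2 ⟨hint, lintegral_tailPower_lt_top (by norm_num)⟩

/-- A continuous `E`-homogeneous function without nontrivial zeros dominates each `|x_k|^{α_k}`. -/
theorem exists_mul_abs_rpow_le_norm {d : ℕ} {α : Fin d → ℝ} (hα : ∀ i, 0 < α i)
    {Λ : (Fin d → ℝ) → ℂ} (hΛc : Continuous Λ)
    (hΛh : ∀ t : ℝ, 0 < t → ∀ x : Fin d → ℝ,
      Λ (fun i => t ^ (1 / α i) * x i) = (t : ℂ) * Λ x)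
    (hΛ0 : ∀ x : Fin d → ℝ, x ≠ 0 → Λ x ≠ 0) :
    ∃ c : ℝ, 0 < c ∧ ∀ (x : Fin d → ℝ) (k : Fin d), c * |x k| ^ α k ≤ ‖Λ x‖ := by
  rcases isEmpty_or_nonempty (Fin d) with hd | hd
  · exact ⟨1, one_pos, fun _ k => hd.elim k⟩
  obtain ⟨z, hz, hmin⟩ := (isCompact_sphere (0 : Fin d → ℝ) 1).exists_isMinOn
    (NormedSpace.sphere_nonempty.2 zero_le_one) hΛc.norm.continuousOn
  have hz0 : z ≠ 0 := by
    rintro rfl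
    simp at hz
  refine ⟨‖Λ z‖, norm_pos_iff.2 (hΛ0 z hz0), fun x k => ?_⟩
  obtain ⟨j, hj⟩ := Finite.exists_max fun i => |x i| ^ α i
  set t := |x j| ^ α j with ht
  have ht0 : 0 ≤ t := by positivity
  rcases ht0.eq_or_lt with h0 | hpos
  · have hk : |x k| ^ α k ≤ 0 := h0 ▸ hj k
    exact (mul_nonpos_of_nonneg_of_nonpos (norm_nonneg _) hk).trans (norm_nonneg _)
  have hscale : ∀ i, t ^ (1 / α i) * (t ^ (-(1 / α i)) * x i) = x i := fun i => by
    rw [← mul_assoc, ← Real.rpow_add hpos, add_neg_cancel, Real.rpow_zero, one_mul]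
  have hroot : ∀ i, (|x i| ^ α i) ^ (1 / α i) = |x i| := fun i => by
    rw [← Real.rpow_mul (abs_nonneg _), mul_one_div_cancel (hα i).ne', Real.rpow_one]
  set w : Fin d → ℝ := fun i => t ^ (-(1 / α i)) * x i with hw
  have hwabs : ∀ i, |w i| = |x i| / t ^ (1 / α i) := fun i => by
    rw [hw, abs_mul, abs_of_nonneg (by positivity), Real.rpow_neg ht0]
    exact (div_eq_inv_mul _ _).symm
  have hw1 : w ∈ Metric.sphere (0 : Fin d → ℝ) 1 := by
    rw [mem_sphere_zero_iff_norm]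
    apply le_antisymm
    · rw [pi_norm_le_iff_of_nonneg zero_le_one]
      intro i
      rw [Real.norm_eq_abs, hwabs, div_le_one (by positivity), ← hroot i]
      exact Real.rpow_le_rpow (by positivity) (hj i) (one_div_nonneg.2 (hα i).le)
    · have hwj : ‖w j‖ = 1 := by
        rw [Real.norm_eq_abs, hwabs, ← hroot j]
        exact div_self (by positivity)
      exact hwj ▸ norm_le_pi_norm w j
  have hΛx : Λ x = (t : ℂ) * Λ w := by
    rw [← hΛh t hpos w]
    exact congrArg Λ (funext fun i => (hscale i).symm)
  rw [hΛx, norm_mul, Complex.norm_real, Real.norm_of_nonneg ht0, mul_comm]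
  exact mul_le_mul (hj k) (hmin hw1) (norm_nonneg _) ht0

theorem ENNReal.rpow_sum_of_nonneg {ι : Type*} (R : ℝ≥0∞) (s : Finset ι) (θ : ι → ℝ)
    (hθ : ∀ k ∈ s, 0 ≤ θ k) : R ^ (∑ k ∈ s, θ k) = ∏ k ∈ s, R ^ θ k := by
  classical
  induction s using Finset.induction_on with
  | empty => simp
  | insert j s hj ih =>
    have hs : ∀ k ∈ s, 0 ≤ θ k := fun k hk => hθ k (mem_insert_of_mem hk)
    rw [sum_insert hj, prod_insert hj,
      ENNReal.rpow_add_of_nonneg _ _ (hθ j (mem_insert_self j s)) (sum_nonneg hs), ih hs]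

/-- Weighted geometric interpolation between the bounds `R ≤ C |y_k|^{-α_k}`. -/
theorem sq_le_mul_prod_rpow {d : ℕ} {α e y : Fin d → ℝ} (hα : ∀ k, 0 < α k) (he : ∀ k, 0 ≤ e k)
    {J : Finset (Fin d)} (hsum : ∑ k ∈ J, e k / α k = 2) {R C : ℝ≥0∞}
    (hR : ∀ k ∈ J, R ≤ C * (‖y k‖ₑ⁻¹) ^ α k) :
    R ^ 2 ≤ C ^ 2 * ∏ k ∈ J, (‖y k‖ₑ⁻¹) ^ e k := by
  have hθ : ∀ k ∈ J, 0 ≤ e k / α k := fun k _ => div_nonneg (he k) (hα k).le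
  have hpow : ∀ X : ℝ≥0∞, X ^ 2 = ∏ k ∈ J, X ^ (e k / α k) := fun X => by
    rw [← ENNReal.rpow_sum_of_nonneg X J _ hθ, hsum]
    norm_num
  rw [hpow R, hpow C, ← prod_mul_distrib]
  refine prod_le_prod' fun k hk => (ENNReal.rpow_le_rpow (hR k hk) (hθ k hk)).trans_eq ?_
  rw [ENNReal.mul_rpow_of_nonneg _ _ (hθ k hk), ← ENNReal.rpow_mul,
    mul_div_cancel₀ _ (hα k).ne']

/-- Exponents that exceed `1` exactly on `S` and have prescribed weighted sum. -/
theorem exists_exponents {d : ℕ} {α : Fin d → ℝ} (hα : ∀ i, 0 < α i) {S J : Finset (Fin d)}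
    (hSJ : S ⊆ J) (hS : ∑ k ∈ S, 1 / α k < 2) (hJ : 2 < ∑ k ∈ J, 1 / α k) :
    ∃ e : Fin d → ℝ, (∀ k ∈ S, 1 < e k) ∧ (∀ k, 0 ≤ e k) ∧ (∀ k ∉ S, e k < 1) ∧
      (∀ k ∉ J, e k = 0) ∧ ∑ k ∈ J, e k / α k = 2 := by
  classical
  have hsplit := sum_sdiff (f := fun k => 1 / α k) hSJ
  set a := ∑ k ∈ S, 1 / α k
  set b := ∑ k ∈ J \ S, 1 / α k
  have ha : 0 ≤ a := sum_nonneg fun k _ => one_div_nonneg.2 (hα k).le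
  have hb : 0 < b := by linarith
  set μ := (2 - (1 + (2 - a) / 2) * a) / b with hμ
  have hμ0 : 0 ≤ μ := div_nonneg (by nlinarith) hb.le
  have hμ1 : μ < 1 := by
    rw [hμ, div_lt_one hb]
    nlinarith
  refine ⟨fun k => if k ∈ S then 1 + (2 - a) / 2 else if k ∈ J then μ else 0, ?_, ?_, ?_, ?_, ?_⟩
  · intro k hk
    simp only [hk, if_true]
    linarith
  · intro k
    dsimp only
    split_ifs
    · linarith
    · exact hμ0
    · exact le_rfl
  · intro k hk
    simp only [hk, if_false]
    split_ifs
    · exact hμ1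
    · exact one_pos
  · intro k hk
    have hkS : k ∉ S := fun h => hk (hSJ h)
    simp [hk, hkS]
  · rw [← sum_sdiff hSJ]
    have h1 : ∑ k ∈ J \ S,
        (if k ∈ S then 1 + (2 - a) / 2 else if k ∈ J then μ else 0) / α k = μ * b := by
      rw [mul_sum]
      refine sum_congr rfl fun k hk => ?_
      rw [mem_sdiff] at hk
      simp [hk.1, hk.2, div_eq_mul_inv]
    have h2 : ∑ k ∈ S, (if k ∈ S then 1 + (2 - a) / 2 else if k ∈ J then μ else 0) / α k
        = (1 + (2 - a) / 2) * a := by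
      rw [mul_sum]
      refine sum_congr rfl fun k hk => ?_
      simp [hk, div_eq_mul_inv]
    rw [h1, h2, hμ, div_mul_cancel₀ _ hb.ne']
    ring

/-- The product majorant of the dominating function on the region where `S` is the set of
coordinates in `Igt` with `|y_k| > 1`. -/
theorem prod_rpow_mul_prod_min_le {d : ℕ} {Ilt Ieq Igt S : Finset (Fin d)}
    (hdisj1 : Disjoint Ilt Ieq) (hdisj2 : Disjoint Ilt Igt) (hdisj3 : Disjoint Ieq Igt)
    (hcover : Ilt ∪ Ieq ∪ Igt = univ) {e y : Fin d → ℝ}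
    (he : ∀ k ∉ Ieq ∪ Igt, e k = 0) (hS : ∀ k, k ∈ S ↔ k ∈ Igt ∧ 1 < |y k|) :
    (∏ k ∈ Ieq ∪ Igt, (‖y k‖ₑ⁻¹) ^ e k) *
        ∏ k ∈ Ilt ∪ Ieq, min 1 (ENNReal.ofReal (y k ^ 2))⁻¹ ≤
      ∏ k, if k ∈ S then tailPower (e k) (y k) else dampedPower (e k) (y k) := by
  rw [← Fintype.prod_ite_mem (Ieq ∪ Igt), ← Fintype.prod_ite_mem (Ilt ∪ Ieq), ← prod_mul_distrib]
  refine prod_le_prod' fun k _ => ?_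
  have hk : k ∈ Ilt ∪ Ieq ∪ Igt := hcover ▸ mem_univ k
  simp only [mem_union] at hk
  rcases hk with (hk | hk) | hk
  · have h1 : k ∉ Ieq := disjoint_left.1 hdisj1 hk
    have h2 : k ∉ Igt := disjoint_left.1 hdisj2 hk
    simp [hS, hk, h1, h2, he k (by simp [h1, h2]), dampedPower]
  · have h2 : k ∉ Igt := disjoint_left.1 hdisj3 hk
    simp [hS, hk, h2, dampedPower]
  · have h1 : k ∉ Ilt := disjoint_right.1 hdisj2 hk
    have h2 : k ∉ Ieq := disjoint_right.1 hdisj3 hk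
    by_cases hy : 1 < |y k|
    · simp [hS, hk, h1, h2, hy, tailPower]
    · have hsq : y k ^ 2 ≤ 1 := (sq_le_one_iff_abs_le_one _).2 (not_lt.1 hy)
      have hmin : min 1 (ENNReal.ofReal (y k ^ 2))⁻¹ = 1 :=
        min_eq_left (ENNReal.one_le_inv.2 (by simpa using hsq))
      simp only [hS, mem_union, hk, h1, h2, hy, dampedPower, hmin]
      simp

/-- Integrability of the dominating function
`h(y) = (sup_{x∈H_<} |Λ(x + π_≥ y)|⁻²) Π_{k∈I_≤} min{1, 1/y_k²}` on `ℝ^d`,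
formulated with the Lebesgue integral in `[0,∞]` (so that `|Λ(·)|⁻²` may take the
value `∞` and the minimum equals `1` where `y_k = 0`). -/
theorem dominating_function_integrable
    {d : ℕ} (α : Fin d → ℝ) (hα : ∀ i, 0 < α i ∧ α i < 1)
    (Ilt Ieq Igt : Finset (Fin d))
    (hdisj1 : Disjoint Ilt Ieq) (hdisj2 : Disjoint Ilt Igt) (hdisj3 : Disjoint Ieq Igt)
    (hcover : Ilt ∪ Ieq ∪ Igt = univ)
    (hge : 2 < ∑ k ∈ Ieq ∪ Igt, 1 / α k)
    (hgt : ∑ k ∈ Igt, 1 / α k < 2)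
    (Λ : (Fin d → ℝ) → ℂ) (hΛc : Continuous Λ)
    (hΛh : ∀ t : ℝ, 0 < t → ∀ x : Fin d → ℝ,
      Λ (fun i => t ^ (1 / α i) * x i) = (t : ℂ) * Λ x)
    (hΛ0 : ∀ x : Fin d → ℝ, x ≠ 0 → Λ x ≠ 0) :
    (∫⁻ y : Fin d → ℝ,
      (⨆ x ∈ {x : Fin d → ℝ | ∀ k, k ∉ Ilt → x k = 0},
        ((‖Λ (x + fun k => if k ∈ Ieq ∪ Igt then y k else 0)‖₊ : ℝ≥0∞) ^ 2)⁻¹) *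
      ∏ k ∈ Ilt ∪ Ieq, min 1 (ENNReal.ofReal (y k ^ 2))⁻¹) < ⊤ := by
  have hα0 : ∀ i, 0 < α i := fun i => (hα i).1
  obtain ⟨c, hc, hcΛ⟩ := exists_mul_abs_rpow_le_norm hα0 hΛc hΛh hΛ0
  have hexp : ∀ S : Finset (Fin d), S ⊆ Igt →
      ∃ e : Fin d → ℝ, (∀ k ∈ S, 1 < e k) ∧ (∀ k, 0 ≤ e k) ∧ (∀ k ∉ S, e k < 1) ∧
        (∀ k ∉ Ieq ∪ Igt, e k = 0) ∧ ∑ k ∈ Ieq ∪ Igt, e k / α k = 2 := fun S hS =>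
    exists_exponents hα0 (hS.trans subset_union_right)
      ((sum_le_sum_of_subset_of_nonneg hS fun k _ _ =>
        one_div_nonneg.2 (hα0 k).le).trans_lt hgt) hge
  choose! e he1 he0 helt heJ hesum using hexp
  obtain ⟨C, hC⟩ : ∃ C : ℝ≥0∞, C = (ENNReal.ofReal c)⁻¹ := ⟨_, rfl⟩
  have hCtop : C ^ 2 ≠ ⊤ := 
    ENNReal.pow_ne_top (hC ▸ ENNReal.inv_ne_top.2 (by simpa using hc))
  set F : Finset (Fin d) → Fin d → ℝ → ℝ≥0∞ := fun S k =>
    if k ∈ S then tailPower (e S k) else dampedPower (e S k) with hF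
  have hFm : ∀ S k, Measurable (F S k) := fun S k => by
    simp only [hF]
    split_ifs
    · exact measurable_tailPower _
    · exact measurable_dampedPower _
  have hbound : ∀ y : Fin d → ℝ,
      (⨆ x ∈ {x : Fin d → ℝ | ∀ k, k ∉ Ilt → x k = 0},
        ((‖Λ (x + fun k => if k ∈ Ieq ∪ Igt then y k else 0)‖₊ : ℝ≥0∞) ^ 2)⁻¹) *
      ∏ k ∈ Ilt ∪ Ieq, min 1 (ENNReal.ofReal (y k ^ 2))⁻¹
        ≤ ∑ S ∈ Igt.powerset, C ^ 2 * ∏ k, F S k (y k) := by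
    intro y
    set S := Igt.filter fun k => 1 < |y k| with hS
    have hSI : S ⊆ Igt := filter_subset _ _
    refine le_trans ?_ (single_le_sum (f := fun S => C ^ 2 * ∏ k, F S k (y k))
      (fun _ _ => zero_le) (mem_powerset.2 hSI))
    have hsup : (⨆ x ∈ {x : Fin d → ℝ | ∀ k, k ∉ Ilt → x k = 0},
        ((‖Λ (x + fun k => if k ∈ Ieq ∪ Igt then y k else 0)‖₊ : ℝ≥0∞) ^ 2)⁻¹)
        ≤ C ^ 2 * ∏ k ∈ Ieq ∪ Igt, (‖y k‖ₑ⁻¹) ^ e S k := by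
      refine iSup₂_le fun x hx => ?_
      rw [ENNReal.inv_pow]
      refine sq_le_mul_prod_rpow hα0 (he0 S hSI) (hesum S hSI) fun k hk => ?_
      have hkI : k ∉ Ilt := by
        rcases mem_union.1 hk with h | h
        · exact disjoint_right.1 hdisj1 h
        · exact disjoint_right.1 hdisj2 h
      have hle := hcΛ (x + fun k => if k ∈ Ieq ∪ Igt then y k else 0) k
      simp only [Pi.add_apply, hx k hkI, hk, if_true, zero_add] at hle
      rw [ENNReal.inv_rpow, hC, ← ENNReal.mul_inv (.inr (by simp [(hα0 k).le]))
        (.inl ENNReal.ofReal_ne_top), ENNReal.inv_le_inv, Real.enorm_eq_ofReal_abs,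
        ENNReal.ofReal_rpow_of_nonneg (abs_nonneg _) (hα0 k).le, ← ENNReal.ofReal_mul hc.le]
      exact (ENNReal.ofReal_le_ofReal hle).trans_eq (ofReal_norm _)
    refine (mul_le_mul_left hsup _).trans ?_
    rw [mul_assoc]
    refine mul_le_mul_right ((prod_rpow_mul_prod_min_le hdisj1 hdisj2 hdisj3 hcover (heJ S hSI)
      fun k => mem_filter).trans_eq (prod_congr rfl fun k _ => ?_)) _
    simp only [hF]
    split_ifs <;> rfl
  refine (lintegral_mono hbound).trans_lt ?_
  have hPm : ∀ S, Measurable fun y : Fin d → ℝ => ∏ k, F S k (y k) := fun S =>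
    Finset.measurable_prod _ fun k _ => (hFm S k).comp (measurable_pi_apply k)
  rw [lintegral_finsetSum _ fun S _ => (hPm S).const_mul _]
  refine ENNReal.sum_lt_top.2 fun S hS => ?_
  have hSI := mem_powerset.1 hS
  rw [lintegral_const_mul' _ _ hCtop, lintegral_fin_prod_eq_prod _ (hFm S)]
  refine ENNReal.mul_lt_top hCtop.lt_top (ENNReal.prod_lt_top fun k _ => ?_)
  simp only [hF]
  split_ifs with hk
  · exact lintegral_tailPower_lt_top (he1 S hSI k hk)
  · exact lintegral_dampedPower_lt_top (he0 S hSI k) (helt S hSI k hk)
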